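/- arXiv:1704.02607 — 2 statements merged into one kernel-verified Lean document; each statement's English description precedes it below -/
import Mathlib

section
/- Suppose every A_i is stable, and let s_1, …, s_p be the simple loops of G. For each simple loop s_i set λ_{s_i} = min{λ_r : (r,u) is an edge of s_i} and ν_i = (Σ_{(r,u)∈E(s_i)} ln‖P_u⁻¹P_r‖)/λ_{s_i}. Let τ_1, …, τ_p be positive reals with τ_i > ν_i for every i ∈ {1,…,p}. Let σ be a G-admissible signal with the following property: for every m ≥ 1 there is a partition of the edge-index set {1, …, m−1} of the path σ_1⋯σ_m (where edge j is (σ_j, σ_{j+1}) and carries duration t_j − t_{j−1}) into blocks such that each block, read in increasing order of indices, traces the consecutive edges of some simple loop s_i of G and satisfies Σ_{j∈block} (t_j − t_{j−1}) ≥ τ_i, except for at most one residual block of at most k−1 indices. Then the switched system is asymptotically stable for σ. -/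
open Matrix Filter Topology Finset

attribute [local instance] Classical.propDecidable

noncomputable section

/-- The spectral (ℓ² operator) norm of a complex square matrix. -/
def sNorm {n : ℕ} (M : Matrix (Fin n) (Fin n) ℂ) : ℝ :=
  ‖Matrix.toEuclideanCLM (𝕜 := ℂ) M‖

/-- The spectral (ℓ² operator) norm of a real square matrix. -/
def sNormR {n : ℕ} (M : Matrix (Fin n) (Fin n) ℝ) : ℝ :=
  ‖Matrix.toEuclideanCLM (𝕜 := ℝ) M‖

/-- The ordered product `exp(A_{σ_m}(t_m - t_{m-1})) ⋯ exp(A_{σ_1} t_1)` of the switched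
system (0-based: `flow A t v m = exp((t m - t (m-1)) • A (v (m-1))) * ⋯ * exp((t 1 - t 0) • A (v 0))`). -/
def flow {n k : ℕ} (A : Fin k → Matrix (Fin n) (Fin n) ℝ)
    (t : ℕ → ℝ) (v : ℕ → Fin k) : ℕ → Matrix (Fin n) (Fin n) ℝ
  | 0 => 1
  | m + 1 => NormedSpace.exp ((t (m + 1) - t m) • A (v m)) * flow A t v m

/-- Piecewise evaluation: the value `f m` on the interval `[t m, t (m+1))`. -/
def pc {α : Type*} (t : ℕ → ℝ) (f : ℕ → α) (d : α) (s : ℝ) : α :=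
  if h : ∃ m, t m ≤ s ∧ s < t (m + 1) then f h.choose else d

/-- The solution of the switched system `x' = A_{σ(t)} x`, `x(0) = x0`:
for `s ∈ [t m, t (m+1))`, `x(s) = exp((s - t m) • A (v m)) * flow A t v m * x0`. -/
def sol {n k : ℕ} (A : Fin k → Matrix (Fin n) (Fin n) ℝ)
    (t : ℕ → ℝ) (v : ℕ → Fin k) (x0 : EuclideanSpace ℝ (Fin n)) (s : ℝ) :
    EuclideanSpace ℝ (Fin n) :=
  pc t (fun m => Matrix.toEuclideanCLM (𝕜 := ℝ)
    (NormedSpace.exp ((s - t m) • A (v m)) * flow A t v m) x0) 0 s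

/-- A `G`-admissible switching signal: `t 0 = 0`, strictly increasing switching times tending
to infinity, and consecutive vertices joined by edges of `G`.  Here `v m` is the vertex active
on `[t m, t (m+1))` (i.e. `v m = σ_{m+1}` in 1-based notation). -/
def Admissible {k : ℕ} (E : Set (Fin k × Fin k)) (t : ℕ → ℝ) (v : ℕ → Fin k) : Prop :=
  t 0 = 0 ∧ StrictMono t ∧ Tendsto t atTop atTop ∧ ∀ m, (v m, v (m + 1)) ∈ E

/-- A real matrix is stable if all its (complex) eigenvalues have negative real part. -/
def MStable {n : ℕ} (M : Matrix (Fin n) (Fin n) ℝ) : Prop :=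
  ∀ z ∈ spectrum ℂ (M.map (Complex.ofReal)), z.re < 0

/-- A real matrix is unstable if some eigenvalue has positive real part and no eigenvalue has
zero real part. -/
def MUnstable {n : ℕ} (M : Matrix (Fin n) (Fin n) ℝ) : Prop :=
  (∃ z ∈ spectrum ℂ (M.map (Complex.ofReal)), 0 < z.re) ∧
    ∀ z ∈ spectrum ℂ (M.map (Complex.ofReal)), z.re ≠ 0

/-- `a` is the maximum of the real parts of the eigenvalues of `M`. -/
def MaxRe {n : ℕ} (M : Matrix (Fin n) (Fin n) ℝ) (a : ℝ) : Prop :=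
  IsGreatest (Complex.re '' spectrum ℂ (M.map (Complex.ofReal))) a

/-- `M = P D P⁻¹` with `P` invertible and `D` diagonal (diagonalizability over `ℂ`). -/
def Diagonalized {n : ℕ} (M : Matrix (Fin n) (Fin n) ℝ)
    (P D : Matrix (Fin n) (Fin n) ℂ) : Prop :=
  IsUnit P ∧ D.IsDiag ∧ M.map (Complex.ofReal) = P * D * P⁻¹

/-- Asymptotic stability of the switched system for the given signal. -/
def AsympStable {n k : ℕ} (A : Fin k → Matrix (Fin n) (Fin n) ℝ)
    (t : ℕ → ℝ) (v : ℕ → Fin k) : Prop :=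
  ∀ x0 : EuclideanSpace ℝ (Fin n), Tendsto (fun s => ‖sol A t v x0 s‖) atTop (𝓝 0)

/-- Membership in the class `S_G(τ, η)`: dwell time at least `τ` in the stable subsystems
(indices `< r`), flee time at most `η` in the unstable subsystems (indices `≥ r`). -/
def InSG {k : ℕ} (r : ℕ) (τ η : ℝ) (t : ℕ → ℝ) (v : ℕ → Fin k) : Prop :=
  ∀ m, ((v m).1 < r → τ ≤ t (m + 1) - t m) ∧ (r ≤ (v m).1 → t (m + 1) - t m ≤ η)

end

/-- A simple loop of the digraph with edge set `E`: a directed closed path of length `len ≥ 1`,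
presented as a `len`-periodic vertex sequence, all of whose vertices (within one period) are
distinct, whose consecutive vertices are joined by edges of `E`. -/
structure SimpleLoop (k : ℕ) (E : Set (Fin k × Fin k)) : Type where
  len : ℕ
  pos : 0 < len
  vtx : ℕ → Fin k
  periodic : ∀ j, vtx (j + len) = vtx j
  inj : ∀ a b, a < len → b < len → vtx a = vtx b → a = b
  edge : ∀ j, (vtx j, vtx (j + 1)) ∈ E

/-- The edge set of a simple loop. -/
def loopEdges {k : ℕ} {E : Set (Fin k × Fin k)} (c : SimpleLoop k E) : Set (Fin k × Fin k) :=
  {e | ∃ j < c.len, e = (c.vtx j, c.vtx (j + 1))}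

lemma sNorm_mul {n : ℕ} (M N : Matrix (Fin n) (Fin n) ℂ) :
    sNorm (M * N) ≤ sNorm M * sNorm N := by
  unfold sNorm
  rw [map_mul]
  exact norm_mul_le _ _

lemma sNorm_nonneg {n : ℕ} (M : Matrix (Fin n) (Fin n) ℂ) : 0 ≤ sNorm M := norm_nonneg _

lemma sNorm_pos_of_isUnit {n : ℕ} [Nonempty (Fin n)] (M : Matrix (Fin n) (Fin n) ℂ)
    (h : IsUnit M) : 0 < sNorm M := by
  unfold sNorm
  rw [norm_pos_iff]
  intro h0
  rw [EmbeddingLike.map_eq_zero_iff] at h0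
  exact h.ne_zero h0

lemma norm_toEuclideanCLM_le {n : ℕ} (M : Matrix (Fin n) (Fin n) ℝ)
    (x : EuclideanSpace ℝ (Fin n)) :
    ‖Matrix.toEuclideanCLM (𝕜 := ℝ) M x‖ ≤ sNorm (M.map Complex.ofReal) * ‖x‖ := by
  set z : EuclideanSpace ℂ (Fin n) := WithLp.toLp 2 (fun i => (x i : ℂ)) with hz
  have h1 : ‖z‖ = ‖x‖ := by
    simp [EuclideanSpace.norm_eq, hz]
  have h2 : ‖Matrix.toEuclideanCLM (𝕜 := ℂ) (M.map Complex.ofReal) z‖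
      = ‖Matrix.toEuclideanCLM (𝕜 := ℝ) M x‖ := by
    rw [EuclideanSpace.norm_eq, EuclideanSpace.norm_eq]
    congr 1
    refine Finset.sum_congr rfl fun i _ => ?_
    have : (Matrix.toEuclideanCLM (𝕜 := ℂ) (M.map Complex.ofReal) z) i
      = (((Matrix.toEuclideanCLM (𝕜 := ℝ) M x) i : ℝ) : ℂ) := by
      simp [hz, Matrix.mulVec, dotProduct]
    rw [this, Complex.norm_real]
  rw [← h1, ← h2]
  exact ContinuousLinearMap.le_opNorm _ _

open scoped Matrix.Norms.L2Operator in
lemma sNorm_diagonal {n : ℕ} (d : Fin n → ℂ) : sNorm (Matrix.diagonal d) = ‖d‖ := by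
  rw [← Matrix.l2_opNorm_diagonal]
  rfl

open scoped Matrix.Norms.Operator in
lemma map_exp_ofReal {n : ℕ} (M : Matrix (Fin n) (Fin n) ℝ) :
    (NormedSpace.exp M).map Complex.ofReal = NormedSpace.exp (M.map Complex.ofReal) := by
  have hc : Continuous (Complex.ofRealHom.mapMatrix (m := Fin n)) := by
    refine Continuous.matrix_map continuous_id Complex.continuous_ofReal
  exact NormedSpace.map_exp (Complex.ofRealHom.mapMatrix (m := Fin n)) hc M

lemma exp_factor {n : ℕ} (M : Matrix (Fin n) (Fin n) ℝ) (P D : Matrix (Fin n) (Fin n) ℂ)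
    (h : Diagonalized M P D) (l : ℝ) (hl : MaxRe M (-l)) (s : ℝ) (hs : 0 ≤ s) :
    ∃ X : Matrix (Fin n) (Fin n) ℂ,
      (NormedSpace.exp (s • M)).map Complex.ofReal = P * X * P⁻¹ ∧
      sNorm X ≤ Real.exp (-l * s) := by
  obtain ⟨hP, hD, hM⟩ := h
  obtain ⟨d, rfl⟩ : ∃ d, D = Matrix.diagonal d := ⟨_, hD.diagonal_diag.symm⟩
  refine ⟨NormedSpace.exp ((s : ℂ) • Matrix.diagonal d), ?_, ?_⟩
  · rw [map_exp_ofReal, ← Matrix.exp_conj _ _ hP]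
    congr 1
    have : (s • M).map Complex.ofReal = (s : ℂ) • M.map Complex.ofReal := by
      ext i j; simp
    rw [this, hM]
    simp
  · rw [← Matrix.diagonal_smul, Matrix.exp_diagonal, sNorm_diagonal,
      pi_norm_le_iff_of_nonneg (Real.exp_nonneg _)]
    intro i
    rw [Pi.coe_exp, ← Complex.exp_eq_exp_ℂ, Complex.norm_exp]
    refine Real.exp_le_exp.2 ?_
    have hi : d i ∈ spectrum ℂ (M.map Complex.ofReal) := by
      obtain ⟨u, rfl⟩ := hP
      rw [hM, ← Matrix.coe_units_inv, spectrum.units_conjugate, spectrum_diagonal]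
      exact ⟨i, rfl⟩
    have := hl.2 ⟨_, hi, rfl⟩
    simp
    nlinarith

lemma sum_shift (f : ℕ → ℝ) (L : ℕ) (hf : ∀ j, f (j + L) = f j) (o : ℕ) :
    ∑ a ∈ Finset.range L, f (o + a) = ∑ a ∈ Finset.range L, f a := by
  induction o with
  | zero => simp
  | succ o ih =>
    rw [← ih]
    have h1 := Finset.sum_range_succ (fun a => f (o + a)) L
    have h2 := Finset.sum_range_succ' (fun a => f (o + a)) L
    have h3 : ∑ a ∈ Finset.range L, f (o + 1 + a) = ∑ a ∈ Finset.range L, f (o + (a + 1)) :=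
      Finset.sum_congr rfl fun a _ => by congr 1; ring
    have := hf o
    rw [h3]
    simp only [add_zero] at h2
    linarith

lemma loop_mod {k : ℕ} {E : Set (Fin k × Fin k)} (c : SimpleLoop k E) (j : ℕ) :
    c.vtx j = c.vtx (j % c.len) := by
  have : Function.Periodic c.vtx c.len := c.periodic
  exact (this.map_mod_nat j).symm

lemma loop_len_le {k : ℕ} {E : Set (Fin k × Fin k)} (c : SimpleLoop k E) : c.len ≤ k := by
  have := Fintype.card_le_of_injective (fun a : Fin c.len => c.vtx a)
    (fun a b h => Fin.ext (c.inj a b a.2 b.2 h))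
  simpa using this

lemma exists_pos_le {p : ℕ} (f : Fin p → ℝ) (hf : ∀ i, 0 < f i) :
    ∃ ε > 0, ∀ i, ε ≤ f i := by
  rcases isEmpty_or_nonempty (Fin p) with h | h
  · exact ⟨1, one_pos, fun i => h.elim i⟩
  · obtain ⟨i, hi⟩ := Finite.exists_min f
    exact ⟨f i, hf i, hi⟩

lemma exists_upper {p : ℕ} (f : Fin p → ℝ) : ∃ C, 0 ≤ C ∧ ∀ i, f i ≤ C := by
  refine ⟨∑ i, |f i|, Finset.sum_nonneg fun i _ => abs_nonneg _, fun i => ?_⟩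
  exact (le_abs_self _).trans
    (Finset.single_le_sum (f := fun i => |f i|) (fun i _ => abs_nonneg _) (Finset.mem_univ i))

/-- simple loop dwell time, all subsystems stable: `s_1,…,s_p` are the simple
loops of `G`, `λ_{s_i}` is the minimum of the `λ` over the sources of the edges of `s i`,
and `ν_i = (Σ_{edges of s i} ln‖P_u⁻¹P_r‖)/λ_{s_i}`.  Suppose `τ_i > ν_i` for every `i` and
that for every `m ≥ 1` the edge-index set `{0,…,m-2}` of the path `σ_1⋯σ_m` (0-based: edge
`j` is `(v j, v (j+1))` with duration `t (j+1) - t j`) can be partitioned into blocks, each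
tracing in increasing order the consecutive edges of some simple loop `s i` (from some
offset `o` along the loop) with total duration at least `τ i`, plus at most one residual
block of at most `k - 1` indices.  Then the switched system is asymptotically stable. -/
theorem stability_simple_loop_dwell_time {n k p : ℕ} (E : Set (Fin k × Fin k))
    (A : Fin k → Matrix (Fin n) (Fin n) ℝ) (P D : Fin k → Matrix (Fin n) (Fin n) ℂ)
    (hdiag : ∀ i, Diagonalized (A i) (P i) (D i))
    (hstab : ∀ i, MStable (A i))
    (lam : Fin k → ℝ) (hlam : ∀ i, MaxRe (A i) (-(lam i)))
    (s : Fin p → SimpleLoop k E)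
    (hcomplete : ∀ c : SimpleLoop k E, ∃ i : Fin p, loopEdges c = loopEdges (s i))
    (lamS : Fin p → ℝ)
    (hlamS : ∀ i : Fin p, IsLeast {x : ℝ | ∃ j < (s i).len, x = lam ((s i).vtx j)} (lamS i))
    (τ : Fin p → ℝ) (hτpos : ∀ i, 0 < τ i)
    (hτ : ∀ i : Fin p,
      (∑ j ∈ Finset.range (s i).len,
          Real.log (sNorm ((P ((s i).vtx (j + 1)))⁻¹ * P ((s i).vtx j)))) / lamS i < τ i)
    (t : ℕ → ℝ) (v : ℕ → Fin k) (hadm : Admissible E t v)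
    (hdec : ∀ m : ℕ, 1 ≤ m → ∃ (B : Finset (Finset ℕ)) (R : Finset ℕ),
      Set.PairwiseDisjoint (B : Set (Finset ℕ)) id ∧
      (∀ b ∈ B, Disjoint b R) ∧
      R ∪ B.biUnion id = Finset.range (m - 1) ∧
      R.card ≤ k - 1 ∧
      (∀ b ∈ B, ∃ (i : Fin p) (o : ℕ) (hb : b.card = (s i).len),
        (∀ a : Fin b.card,
          v ((b.orderIsoOfFin rfl a).1) = (s i).vtx (o + (a : ℕ)) ∧
          v ((b.orderIsoOfFin rfl a).1 + 1) = (s i).vtx (o + (a : ℕ) + 1)) ∧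
        τ i ≤ ∑ j ∈ b, (t (j + 1) - t j))) :
    AsympStable A t v := by
  obtain ⟨ht0, htm, htt, hE⟩ := hadm
  have hk : Nonempty (Fin k) := ⟨v 0⟩
  have hlpos : ∀ i, 0 < lam i := by
    intro i
    obtain ⟨z, hz, hz'⟩ := (hlam i).1
    have := hstab i z hz
    linarith
  have hn : Nonempty (Fin n) := by
    by_contra h
    rw [not_nonempty_iff] at h
    obtain ⟨z, hz, hz'⟩ := (hlam (v 0)).1
    rw [spectrum.of_subsingleton] at hz
    exact hz
  have hd : ∀ j, 0 < t (j + 1) - t j := fun j => sub_pos.2 (htm (Nat.lt_succ_self j))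
  set N : ℕ → ℝ := fun j => Real.log (sNorm ((P (v (j + 1)))⁻¹ * P (v j))) with hN
  set F : ℕ → ℝ := fun j => N j - lam (v j) * (t (j + 1) - t j) with hF
  have hNpos : ∀ j, 0 < sNorm ((P (v (j + 1)))⁻¹ * P (v j)) := fun j =>
    sNorm_pos_of_isUnit _ (((Matrix.isUnit_nonsing_inv_iff).2 (hdiag _).1).mul (hdiag _).1)
  -- growth bound of the conjugated flow
  set W : ℕ → ℝ := fun m => sNorm ((P (v m))⁻¹ * (flow A t v m).map Complex.ofReal) with hW
  have hWs : ∀ m, W (m + 1) ≤ Real.exp (F m) * W m := by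
    intro m
    obtain ⟨X, hX, hXn⟩ := exp_factor _ _ _ (hdiag (v m)) _ (hlam (v m)) _ (hd m).le
    have e1 : (flow A t v (m + 1)).map Complex.ofReal
        = (P (v m) * X * (P (v m))⁻¹) * (flow A t v m).map Complex.ofReal := by
      rw [← hX, flow]
      exact Matrix.map_mul (f := Complex.ofRealHom)
    have e2 : (P (v (m + 1)))⁻¹ * (flow A t v (m + 1)).map Complex.ofReal
        = ((P (v (m + 1)))⁻¹ * P (v m)) * (X * ((P (v m))⁻¹ * (flow A t v m).map Complex.ofReal)) := by
      rw [e1]; simp only [Matrix.mul_assoc]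
    have e3 : Real.exp (F m) = sNorm ((P (v (m + 1)))⁻¹ * P (v m))
        * Real.exp (-lam (v m) * (t (m + 1) - t m)) := by
      rw [← Real.exp_log (hNpos m), ← Real.exp_add]
      congr 1
      simp only [hF, hN]; ring
    simp only [hW]
    rw [e2, e3, mul_assoc (sNorm _)]
    refine (sNorm_mul _ _).trans (mul_le_mul_of_nonneg_left ?_ (sNorm_nonneg _))
    refine (sNorm_mul _ _).trans (mul_le_mul_of_nonneg_right hXn (sNorm_nonneg _))
  have hWb : ∀ m, W m ≤ Real.exp (∑ j ∈ Finset.range m, F j) * W 0 := by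
    intro m
    induction m with
    | zero => simp
    | succ m ih =>
      rw [Finset.sum_range_succ, Real.exp_add, mul_comm (Real.exp _) (Real.exp (F m)), mul_assoc]
      exact (hWs m).trans (mul_le_mul_of_nonneg_left ih (Real.exp_nonneg _))
  -- uniform constants
  have hlS : ∀ i, 0 < lamS i := by
    intro i
    obtain ⟨j, _, hj⟩ := (hlamS i).1
    rw [hj]; exact hlpos _
  set S : Fin p → ℝ := fun i => ∑ j ∈ Finset.range (s i).len,
          Real.log (sNorm ((P ((s i).vtx (j + 1)))⁻¹ * P ((s i).vtx j))) with hS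
  obtain ⟨ε, hε, hεi⟩ := exists_pos_le (fun i => lamS i * τ i - S i) (by
    intro i
    have := hτ i
    rw [div_lt_iff₀ (hlS i)] at this
    simp only [hS]; linarith)
  obtain ⟨C, hC, hNC⟩ : ∃ C, 0 ≤ C ∧ ∀ j, N j ≤ C := by
    choose c hc0 hc using fun u : Fin k =>
      exists_upper (fun r : Fin k => Real.log (sNorm ((P u)⁻¹ * P r)))
    obtain ⟨C, hC, h⟩ := exists_upper c
    exact ⟨C, hC, fun j => (hc (v (j + 1)) (v j)).trans (h _)⟩
  have hblock : ∀ b : Finset ℕ, (∃ (i : Fin p) (o : ℕ) (hb : b.card = (s i).len),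
        (∀ a : Fin b.card,
          v ((b.orderIsoOfFin rfl a).1) = (s i).vtx (o + (a : ℕ)) ∧
          v ((b.orderIsoOfFin rfl a).1 + 1) = (s i).vtx (o + (a : ℕ) + 1)) ∧
        τ i ≤ ∑ j ∈ b, (t (j + 1) - t j)) → b.card ≤ k ∧ ∑ j ∈ b, F j ≤ -ε := by
    rintro b ⟨i, o, hb, hv, hτb⟩
    refine ⟨hb ▸ loop_len_le _, ?_⟩
    have hre : ∀ g : ℕ → ℝ, ∑ j ∈ b, g j = ∑ a : Fin b.card, g (b.orderIsoOfFin rfl a).1 := by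
      intro g
      rw [← Finset.sum_coe_sort b g]
      exact (Equiv.sum_comp (b.orderIsoOfFin rfl).toEquiv (fun x : b => g x.1)).symm
    have h1 : ∑ j ∈ b, N j = S i := by
      rw [hre, hS]
      set f : ℕ → ℝ := fun j =>
        Real.log (sNorm ((P ((s i).vtx (j + 1)))⁻¹ * P ((s i).vtx j))) with hf
      have hfp : ∀ j, f (j + (s i).len) = f j := by
        intro j
        simp only [hf]
        rw [(s i).periodic, show j + (s i).len + 1 = (j + 1) + (s i).len by ring, (s i).periodic]
      change _ = ∑ j ∈ Finset.range (s i).len, f j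
      rw [← sum_shift f _ hfp o, ← hb, ← Fin.sum_univ_eq_sum_range (fun a => f (o + a))]
      refine Finset.sum_congr rfl fun a _ => ?_
      simp only [hN, hf, (hv a).1, (hv a).2]
    have h2 : lamS i * ∑ j ∈ b, (t (j + 1) - t j) ≤ ∑ j ∈ b, lam (v j) * (t (j + 1) - t j) := by
      rw [Finset.mul_sum, hre, hre]
      refine Finset.sum_le_sum fun a _ => ?_
      refine mul_le_mul_of_nonneg_right ?_ (hd _).le
      refine (hlamS i).2 ⟨(o + a) % (s i).len, Nat.mod_lt _ (s i).pos, ?_⟩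
      rw [(hv a).1, loop_mod]
    have h3 : ∑ j ∈ b, F j = ∑ j ∈ b, N j - ∑ j ∈ b, lam (v j) * (t (j + 1) - t j) :=
      Finset.sum_sub_distrib _ _
    have h4 := hεi i
    have h5 := mul_le_mul_of_nonneg_left hτb (hlS i).le
    linarith
  have hk0 : (0 : ℝ) < k := by
    have : 0 < k := (v 0).pos
    exact_mod_cast this
  have hsum : ∀ m : ℕ, ∑ j ∈ Finset.range m, F j ≤ k * C - ε * ((m - k) / k) := by
    intro m
    obtain ⟨B, R, hB1, hB2, hB3, hB4, hB5⟩ := hdec (m + 1) (by omega)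
    rw [Nat.add_sub_cancel] at hB3
    have hdis : Disjoint R (B.biUnion id) := by
      rw [Finset.disjoint_biUnion_right]
      exact fun b hb => (hB2 b hb).symm
    have hb := fun b hb => hblock b (hB5 b hb)
    have hRk : (R.card : ℝ) ≤ k := by exact_mod_cast hB4.trans (Nat.sub_le _ _)
    have hcard : (m : ℝ) ≤ k + B.card * k := by
      have h1 : (Finset.range m).card = R.card + ∑ b ∈ B, b.card := by
        rw [← hB3, Finset.card_union_of_disjoint hdis, Finset.card_biUnion hB1]; rfl
      have h2 : ∑ b ∈ B, b.card ≤ B.card * k := by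
        simpa using Finset.sum_le_card_nsmul B _ k (fun b h => (hb b h).1)
      rw [Finset.card_range] at h1
      have h2' : ((∑ b ∈ B, b.card : ℕ) : ℝ) ≤ B.card * k := by exact_mod_cast h2
      rw [h1]; push_cast at h2' ⊢; linarith
    rw [← hB3, Finset.sum_union hdis, Finset.sum_biUnion hB1]
    have h3 : ∑ j ∈ R, F j ≤ k * C := by
      have : ∑ j ∈ R, F j ≤ R.card • C := Finset.sum_le_card_nsmul R _ C (fun j _ => by
        have := mul_pos (hlpos (v j)) (hd j)
        have := hNC j
        simp only [hF]; linarith)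
      rw [nsmul_eq_mul] at this
      exact this.trans (mul_le_mul_of_nonneg_right hRk hC)
    have h4 : ∑ b ∈ B, ∑ j ∈ id b, F j ≤ B.card * (-ε) := by
      simpa using Finset.sum_le_card_nsmul B (fun b => ∑ j ∈ b, F j) (-ε) (fun b h => (hb b h).2)
    have h5 : ((m : ℝ) - k) / k ≤ B.card := by
      rw [div_le_iff₀ hk0]; linarith
    have h6 := mul_le_mul_of_nonneg_left h5 hε.le
    linarith
  obtain ⟨Q, hQ, hQi⟩ := exists_upper (fun i : Fin k => sNorm (P i))
  intro x0
  -- pointwise bound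
  set U : ℕ → ℝ := fun m => Q * (Real.exp (k * C - ε * ((m - k) / k)) * W 0) * ‖x0‖ with hU
  have hW0 : 0 ≤ W 0 := sNorm_nonneg _
  have hU0 : ∀ m, 0 ≤ U m := fun m => by positivity
  have hUlim : Tendsto U atTop (𝓝 0) := by
    have h1 : Tendsto (fun m : ℕ => (k : ℝ) * C - ε * (((m : ℝ) - k) / k)) atTop atBot := by
      have : Tendsto (fun m : ℕ => ε * (((m : ℝ) - k) / k)) atTop atTop :=
        ((tendsto_atTop_add_const_right _ (-(k : ℝ))
          tendsto_natCast_atTop_atTop).atTop_div_const hk0).const_mul_atTop hε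
      simpa [sub_eq_add_neg] using
        tendsto_atBot_add_const_left _ ((k : ℝ) * C) (tendsto_neg_atTop_atBot.comp this)
    have h2 := (((Real.tendsto_exp_atBot.comp h1).mul_const (W 0)).const_mul Q).mul_const ‖x0‖
    simpa [hU] using h2
  have hpt : ∀ (m : ℕ) (r : ℝ), t m ≤ r →
      ‖Matrix.toEuclideanCLM (𝕜 := ℝ)
        (NormedSpace.exp ((r - t m) • A (v m)) * flow A t v m) x0‖ ≤ U m := by
    intro m r hr
    obtain ⟨X, hX, hXn⟩ := exp_factor _ _ _ (hdiag (v m)) _ (hlam (v m)) _ (sub_nonneg.2 hr)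
    have hX1 : sNorm X ≤ 1 := hXn.trans (Real.exp_le_one_iff.2 (by
      have := mul_nonneg (hlpos (v m)).le (sub_nonneg.2 hr)
      linarith))
    refine (norm_toEuclideanCLM_le _ _).trans (mul_le_mul_of_nonneg_right ?_ (norm_nonneg _))
    have e1 : (NormedSpace.exp ((r - t m) • A (v m)) * flow A t v m).map Complex.ofReal
        = P (v m) * (X * ((P (v m))⁻¹ * (flow A t v m).map Complex.ofReal)) := by
      have : (NormedSpace.exp ((r - t m) • A (v m)) * flow A t v m).map Complex.ofReal
        = (NormedSpace.exp ((r - t m) • A (v m))).map Complex.ofReal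
          * (flow A t v m).map Complex.ofReal := Matrix.map_mul (f := Complex.ofRealHom)
      rw [this, hX]; simp only [Matrix.mul_assoc]
    rw [e1]
    refine (sNorm_mul _ _).trans (mul_le_mul (hQi _) ?_ (sNorm_nonneg _) hQ)
    refine (sNorm_mul _ _).trans ?_
    have h1 : sNorm X * W m ≤ W m := mul_le_of_le_one_left (sNorm_nonneg _) hX1
    refine h1.trans ((hWb m).trans (mul_le_mul_of_nonneg_right ?_ hW0))
    exact Real.exp_le_exp.2 (hsum m)
  rw [Metric.tendsto_atTop]
  intro δ hδ
  obtain ⟨M, hM⟩ := (Metric.tendsto_atTop.1 hUlim) δ hδ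
  refine ⟨t M, fun r hr => ?_⟩
  rw [Real.dist_eq, sub_zero, abs_of_nonneg (norm_nonneg _)]
  unfold sol pc
  split_ifs with h
  · obtain ⟨h1, h2⟩ := h.choose_spec
    have hMm : M ≤ h.choose := by
      have := htm.lt_iff_lt.1 (lt_of_le_of_lt hr h2)
      omega
    have h3 := hM _ hMm
    rw [Real.dist_eq, sub_zero, abs_of_nonneg (hU0 _)] at h3
    exact (hpt _ r h1).trans_lt h3
  · simpa using hδ
end

section
/- Let G be the unidirectional ring on k vertices, with edge set {(i, i+1) : 1 ≤ i ≤ k−1} ∪ {(k, 1)}, so that every G-admissible signal satisfies σ_{m+1} = σ_m + 1 (mod k) and traverses the ring periodically. Suppose A_1, …, A_r are stable and A_{r+1}, …, A_k are unstable (1 ≤ r < k). Let ρ = Π_{(i,j)∈E(G)} ‖P_j⁻¹P_i‖, λ = min{λ_1, …, λ_r}, and μ = max{μ_{r+1}, …, μ_k}. Let τ_1, η_1 > 0 satisfy ln ρ − λ·τ_1 + μ·η_1 < 0. If σ is a G-admissible signal such that in every complete traversal of the ring (every consecutive block of k switching intervals, indices m = qk+1, …, (q+1)k for q ≥ 0)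 the total time Σ (t_m − t_{m−1}) over indices with σ_m ∈ {1,…,r} is at least τ_1 and the total time over indices with σ_m ∈ {r+1,…,k} is at most η_1, then the switched system is asymptotically stable for σ. -/
open Matrix Filter Topology Finset

attribute [local instance] Classical.propDecidable

section Aux

lemma aux_exp (n : ℕ) (M : Matrix (Fin n) (Fin n) ℝ) (P D : Matrix (Fin n) (Fin n) ℂ)
    (h : Diagonalized M P D) (s : ℝ) :
    (NormedSpace.exp (s • M)).map Complex.ofReal =
      P * Matrix.diagonal (fun j => Complex.exp ((s : ℂ) * D j j)) * P⁻¹ := by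
  obtain ⟨hP, hD, hM⟩ := h
  have h1 : (NormedSpace.exp (s • M)).map Complex.ofReal =
      NormedSpace.exp ((s • M).map Complex.ofReal) := by
    open scoped Matrix.Norms.Operator in
    exact NormedSpace.map_exp (Complex.ofRealHom.mapMatrix : Matrix (Fin n) (Fin n) ℝ →+* _)
      (Continuous.matrix_map continuous_id Complex.continuous_ofReal) (s • M)
  have h2 : (s • M).map Complex.ofReal = P * ((s : ℂ) • D) * P⁻¹ := by
    have : (s • M).map Complex.ofReal = (s : ℂ) • M.map Complex.ofReal := by
      ext i j; simp
    rw [this, hM]; simp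
  have h3 : (s : ℂ) • D = Matrix.diagonal (fun j => (s : ℂ) * D j j) := by
    rw [← hD.diagonal_diag]
    ext i j
    by_cases hij : i = j
    · subst hij; simp
    · simp [hij]
  rw [h1, h2, Matrix.exp_conj _ _ hP, h3, Matrix.exp_diagonal]
  congr 3
  ext j
  rw [Pi.coe_exp, Complex.exp_eq_exp_ℂ]

lemma aux_spec (n : ℕ) (M : Matrix (Fin n) (Fin n) ℝ) (P D : Matrix (Fin n) (Fin n) ℂ)
    (h : Diagonalized M P D) (j : Fin n) :
    D j j ∈ spectrum ℂ (M.map Complex.ofReal) := by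
  obtain ⟨⟨u, hu⟩, hD, hM⟩ := h
  rw [hM, ← hu, ← Matrix.coe_units_inv, spectrum.units_conjugate, ← hD.diagonal_diag,
    spectrum_diagonal]
  exact ⟨j, by simp⟩

lemma aux_diag (n : ℕ) (M : Matrix (Fin n) (Fin n) ℝ) (P D : Matrix (Fin n) (Fin n) ℂ)
    (h : Diagonalized M P D) (a : ℝ) (ha : MaxRe M a) (s : ℝ) (hs : 0 ≤ s) :
    sNorm (Matrix.diagonal (fun j => Complex.exp ((s : ℂ) * D j j))) ≤ Real.exp (a * s) := by
  unfold sNorm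
  open scoped Matrix.Norms.L2Operator in
  rw [Matrix.l2_opNorm_toEuclideanCLM, Matrix.l2_opNorm_diagonal]
  refine (pi_norm_le_iff_of_nonneg (Real.exp_pos _).le).mpr fun j => ?_
  rw [Complex.norm_exp]
  have := ha.2 ⟨_, aux_spec n M P D h j, rfl⟩
  simp only [Complex.mul_re, Complex.ofReal_re, Complex.ofReal_im, zero_mul, sub_zero]
  apply Real.exp_le_exp.mpr
  nlinarith

lemma aux_norm (n : ℕ) (M : Matrix (Fin n) (Fin n) ℝ) (x : EuclideanSpace ℝ (Fin n)) :
    ‖Matrix.toEuclideanCLM (𝕜 := ℝ) M x‖ ≤ sNorm (M.map Complex.ofReal) * ‖x‖ := by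
  let y : EuclideanSpace ℂ (Fin n) := WithLp.toLp 2 (fun i => (x i : ℂ))
  have hy : ‖y‖ = ‖x‖ := by
    rw [EuclideanSpace.norm_eq, EuclideanSpace.norm_eq]
    simp [y]
  have h2 : ‖Matrix.toEuclideanCLM (𝕜 := ℂ) (M.map Complex.ofReal) y‖ =
      ‖Matrix.toEuclideanCLM (𝕜 := ℝ) M x‖ := by
    rw [EuclideanSpace.norm_eq, EuclideanSpace.norm_eq]
    congr 1
    refine Finset.sum_congr rfl fun i _ => ?_
    have : (Matrix.toEuclideanCLM (𝕜 := ℂ) (M.map Complex.ofReal) y) i =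
        (((Matrix.toEuclideanCLM (𝕜 := ℝ) M x) i : ℝ) : ℂ) := by
      simp [y, Matrix.mulVec, dotProduct]
    rw [this]; simp
  rw [← h2, ← hy]
  exact ContinuousLinearMap.le_opNorm _ _

lemma aux_map_mul {n : ℕ} (M N : Matrix (Fin n) (Fin n) ℝ) :
    (M * N).map Complex.ofReal = M.map Complex.ofReal * N.map Complex.ofReal :=
  Matrix.map_mul (f := Complex.ofRealHom)

lemma aux_iter (g b : ℕ → ℝ) (hb : ∀ m, 0 ≤ b m)
    (h : ∀ m, g (m + 1) ≤ b m * g m) (a j : ℕ) :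
    g (a + j) ≤ (∏ i ∈ Finset.range j, b (a + i)) * g a := by
  induction j with
  | zero => simp
  | succ j ih =>
    rw [Finset.prod_range_succ, ← add_assoc]
    calc g (a + j + 1) ≤ b (a + j) * g (a + j) := h _
      _ ≤ b (a + j) * ((∏ i ∈ Finset.range j, b (a + i)) * g a) :=
        mul_le_mul_of_nonneg_left ih (hb _)
      _ = _ := by ring

lemma aux_tendsto (k : ℕ) (hk : 0 < k) (g b : ℕ → ℝ) (M c : ℝ) (hg : ∀ m, 0 ≤ g m)
    (hb : ∀ m, 0 ≤ b m) (hbM : ∀ m, b m ≤ M) (h : ∀ m, g (m + 1) ≤ b m * g m)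
    (hc0 : 0 ≤ c) (hc : c < 1)
    (hblk : ∀ q, ∏ i ∈ Finset.range k, b (q * k + i) ≤ c) : Tendsto g atTop (𝓝 0) := by
  have h1 : ∀ q, g (q * k) ≤ c ^ q * g 0 := by
    intro q
    induction q with
    | zero => simp
    | succ q ih =>
      rw [Nat.succ_mul]
      calc g (q * k + k) ≤ _ := aux_iter g b hb h _ _
        _ ≤ c * (c ^ q * g 0) := mul_le_mul (hblk q) ih (hg _) hc0
        _ = _ := by ring
  have h2 : ∀ m, g m ≤ (max M 1) ^ k * (c ^ (m / k) * g 0) := by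
    intro m
    have hm : m / k * k + m % k = m := Nat.div_add_mod' m k
    have h3 := aux_iter g b hb h (m / k * k) (m % k)
    rw [hm] at h3
    refine h3.trans (mul_le_mul ?_ (h1 _) (hg _) (by positivity))
    calc _ ≤ ∏ i ∈ Finset.range (m % k), max M 1 :=
          Finset.prod_le_prod (fun _ _ => hb _) (fun _ _ => (hbM _).trans (le_max_left _ _))
      _ = max M 1 ^ (m % k) := by simp
      _ ≤ _ := pow_le_pow_right₀ (le_max_right _ _) (Nat.mod_lt _ hk).le
  have h4 : Tendsto (fun m : ℕ => (max M 1) ^ k * (c ^ (m / k) * g 0)) atTop (𝓝 0) := by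
    have := ((tendsto_pow_atTop_nhds_zero_of_lt_one hc0 hc).comp
      (Nat.tendsto_div_const_atTop hk.ne')).mul_const (g 0) |>.const_mul ((max M 1) ^ k)
    simpa using this
  exact squeeze_zero hg h2 h4

end Aux

/-- unidirectional ring, simple loop dwell time: if
`ln ρ − λτ₁ + μη₁ < 0` with `λ` the minimum of the `λ_i` over stable indices and `μ` the
maximum of the `μ_j` over unstable indices, and in every complete traversal of the ring
(every consecutive block of `k` switching intervals) the signal spends total time at least
`τ₁` on stable subsystems and at most `η₁` on unstable subsystems, then the switched system
is asymptotically stable. -/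
theorem ring_stability_loop_dwell_flee {n k : ℕ} [NeZero k] (r : ℕ) (hr : 1 ≤ r) (hrk : r < k)
    (A : Fin k → Matrix (Fin n) (Fin n) ℝ) (P D : Fin k → Matrix (Fin n) (Fin n) ℂ)
    (hdiag : ∀ i, Diagonalized (A i) (P i) (D i))
    (hstab : ∀ i : Fin k, i.1 < r → MStable (A i))
    (hunst : ∀ i : Fin k, r ≤ i.1 → MUnstable (A i))
    (lam mu : Fin k → ℝ)
    (hlam : ∀ i : Fin k, i.1 < r → MaxRe (A i) (-(lam i)))
    (hmu : ∀ i : Fin k, r ≤ i.1 → MaxRe (A i) (mu i))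
    (lmin mumax : ℝ)
    (hlmin : IsLeast {x : ℝ | ∃ i : Fin k, i.1 < r ∧ x = lam i} lmin)
    (hmumax : IsGreatest {x : ℝ | ∃ i : Fin k, r ≤ i.1 ∧ x = mu i} mumax)
    (τ₁ η₁ : ℝ) (hτ : 0 < τ₁) (hη : 0 < η₁)
    (hcond : Real.log (∏ i : Fin k, sNorm ((P (i + 1))⁻¹ * P i)) - lmin * τ₁ + mumax * η₁ < 0)
    (t : ℕ → ℝ) (v : ℕ → Fin k)
    (hadm : Admissible {e : Fin k × Fin k | e.2 = e.1 + 1} t v)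
    (hblock : ∀ q : ℕ,
      τ₁ ≤ (∑ m ∈ (Finset.range k).filter (fun m => (v (q * k + m)).1 < r),
          (t (q * k + m + 1) - t (q * k + m))) ∧
      (∑ m ∈ (Finset.range k).filter (fun m => r ≤ (v (q * k + m)).1),
          (t (q * k + m + 1) - t (q * k + m))) ≤ η₁) :
    AsympStable A t v := by
  obtain ⟨ht0, htm, htt, hE⟩ := hadm
  have hk : 0 < k := by omega
  have hE' : ∀ m, v (m + 1) = v m + 1 := hE
  have hv : ∀ a m : ℕ, v (a + m) = v a + Fin.ofNat k m := by
    intro a m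
    induction m with
    | zero => simp
    | succ m ih =>
      rw [← add_assoc, hE', ih, add_assoc]
      congr 1
      apply Fin.ext
      simp [Fin.val_add, Fin.ofNat]
  -- signs
  have hlpos : 0 < lmin := by
    obtain ⟨i, hi, rfl⟩ := hlmin.1
    obtain ⟨z, hz, hz'⟩ := (hlam i hi).1
    have := hstab i hi z hz
    linarith
  have hmpos : 0 < mumax := by
    obtain ⟨i, hi, rfl⟩ := hmumax.1
    obtain ⟨z, hz, hz'⟩ := (hunst i hi).1
    have := (hmu i hi).2 ⟨z, hz, rfl⟩
    linarith
  have hn : Nontrivial (Matrix (Fin n) (Fin n) ℂ) := by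
    obtain ⟨i, hi, rfl⟩ := hlmin.1
    obtain ⟨z, hz, hz'⟩ := (hlam i hi).1
    by_contra hcon
    rw [not_nontrivial_iff_subsingleton] at hcon
    rw [spectrum.of_subsingleton] at hz
    exact hz
  let N : Fin k → ℝ := fun i => sNorm ((P (i + 1))⁻¹ * P i)
  have hNpos : ∀ i, 0 < N i := by
    intro i
    have hu : IsUnit ((P (i + 1))⁻¹ * P i) :=
      (Matrix.isUnit_nonsing_inv_iff.mpr (hdiag (i + 1)).1).mul (hdiag i).1
    refine norm_pos_iff.mpr fun h0 => hu.ne_zero ?_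
    exact (map_eq_zero_iff _ (Matrix.toEuclideanCLM (n := Fin n) (𝕜 := ℂ)).injective).mp h0
  let a : Fin k → ℝ := fun i => if i.1 < r then -lmin else mumax
  have hdg : ∀ i (s : ℝ), 0 ≤ s →
      sNorm (Matrix.diagonal (fun j => Complex.exp ((s : ℂ) * D i j j))) ≤ Real.exp (a i * s) := by
    intro i s hs
    by_cases hi : i.1 < r
    · refine (aux_diag n _ _ _ (hdiag i) _ (hlam i hi) s hs).trans (Real.exp_le_exp.mpr ?_)
      have := hlmin.2 ⟨i, hi, rfl⟩
      simp only [a, if_pos hi]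
      nlinarith
    · refine (aux_diag n _ _ _ (hdiag i) _ (hmu i (not_lt.mp hi)) s hs).trans
        (Real.exp_le_exp.mpr ?_)
      have := hmumax.2 ⟨i, not_lt.mp hi, rfl⟩
      simp only [a, if_neg hi]
      nlinarith
  have hΔ : ∀ m, 0 ≤ t (m + 1) - t m := fun m => sub_nonneg.mpr (htm (Nat.lt_succ_self m)).le
  have hun : ∀ m, r ≤ (v m).1 → t (m + 1) - t m ≤ η₁ := by
    intro m hm
    have hmk : m / k * k + m % k = m := Nat.div_add_mod' m k
    have h1 := (hblock (m / k)).2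
    refine le_trans ?_ h1
    have h2 := Finset.single_le_sum
      (f := fun j => t (m / k * k + j + 1) - t (m / k * k + j))
      (s := (Finset.range k).filter (fun j => r ≤ (v (m / k * k + j)).1))
      (fun j _ => hΔ _) (a := m % k)
      (by simp only [Finset.mem_filter, Finset.mem_range, hmk]; exact ⟨Nat.mod_lt _ hk, hm⟩)
    simp only [hmk] at h2
    exact h2
  have hexpb : ∀ m (s : ℝ), 0 ≤ s → s ≤ t (m + 1) - t m →
      Real.exp (a (v m) * s) ≤ Real.exp (mumax * η₁) := by
    intro m s hs hs'
    apply Real.exp_le_exp.mpr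
    by_cases hi : (v m).1 < r
    · simp only [a, if_pos hi]
      have := mul_pos hmpos hη
      nlinarith
    · simp only [a, if_neg hi]
      exact mul_le_mul_of_nonneg_left (hs'.trans (hun m (not_lt.mp hi))) hmpos.le
  -- the scalar sequence
  let g : ℕ → ℝ := fun m => sNorm ((P (v m))⁻¹ * (flow A t v m).map Complex.ofReal)
  let b : ℕ → ℝ := fun m => N (v m) * Real.exp (a (v m) * (t (m + 1) - t m))
  have hb : ∀ m, 0 ≤ b m := fun m => mul_nonneg (hNpos _).le (Real.exp_pos _).le
  have hg : ∀ m, 0 ≤ g m := fun m => sNorm_nonneg _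
  have hstep : ∀ m, g (m + 1) ≤ b m * g m := by
    intro m
    have e : (P (v (m + 1)))⁻¹ * (flow A t v (m + 1)).map Complex.ofReal =
        (((P (v m + 1))⁻¹ * P (v m)) * Matrix.diagonal (fun j =>
          Complex.exp (((t (m + 1) - t m : ℝ) : ℂ) * D (v m) j j))) *
        ((P (v m))⁻¹ * (flow A t v m).map Complex.ofReal) := by
      rw [flow, aux_map_mul, aux_exp n _ _ _ (hdiag (v m)), hE']
      simp only [Matrix.mul_assoc]
    simp only [g]
    rw [e]
    refine (sNorm_mul _ _).trans (mul_le_mul_of_nonneg_right ?_ (sNorm_nonneg _))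
    refine (sNorm_mul _ _).trans ?_
    exact mul_le_mul_of_nonneg_left (hdg _ _ (hΔ m)) (sNorm_nonneg _)
  have hρ : 0 < ∏ i : Fin k, N i := Finset.prod_pos fun i _ => hNpos i
  obtain ⟨M, hM⟩ := (Set.finite_range N).bddAbove
  have hblk : ∀ q, ∏ i ∈ Finset.range k, b (q * k + i) ≤
      Real.exp (Real.log (∏ i : Fin k, N i) - lmin * τ₁ + mumax * η₁) := by
    intro q
    simp only [b]
    rw [Finset.prod_mul_distrib, ← Real.exp_sum]
    have e1 : ∏ i ∈ Finset.range k, N (v (q * k + i)) = ∏ i : Fin k, N i := by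
      rw [Finset.prod_range]
      simp only [hv, Fin.ofNat_val_eq_self]
      exact Equiv.prod_comp (Equiv.addLeft (v (q * k))) N
    rw [e1, show Real.log (∏ i : Fin k, N i) - lmin * τ₁ + mumax * η₁ =
      Real.log (∏ i : Fin k, N i) + (- lmin * τ₁ + mumax * η₁) by ring, Real.exp_add,
      Real.exp_log hρ]
    refine mul_le_mul_of_nonneg_left (Real.exp_le_exp.mpr ?_) hρ.le
    rw [← Finset.sum_filter_add_sum_filter_not (Finset.range k)
      (fun m => (v (q * k + m)).1 < r)]
    obtain ⟨hb1, hb2⟩ := hblock q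
    refine add_le_add ?_ ?_
    · rw [Finset.sum_congr rfl (g := fun m => -lmin * (t (q * k + m + 1) - t (q * k + m)))
        (by intro x hx; simp only [a, if_pos (Finset.mem_filter.mp hx).2]), ← Finset.mul_sum]
      nlinarith
    · rw [Finset.sum_congr rfl (g := fun m => mumax * (t (q * k + m + 1) - t (q * k + m)))
        (by intro x hx; simp only [a, if_neg (Finset.mem_filter.mp hx).2]), ← Finset.mul_sum]
      simp only [not_lt]
      exact mul_le_mul_of_nonneg_left hb2 hmpos.le
  have hgt : Tendsto g atTop (𝓝 0) :=
    aux_tendsto k hk g b (M * Real.exp (mumax * η₁)) _ hg hb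
      (fun m => by
        have h1 : N (v m) ≤ M := hM ⟨_, rfl⟩
        exact mul_le_mul h1 (hexpb m _ (hΔ m) le_rfl) (Real.exp_pos _).le
          ((hNpos (v m)).le.trans h1))
      hstep (Real.exp_pos _).le (Real.exp_lt_one_iff.mpr hcond) hblk
  obtain ⟨K, hK⟩ := (Set.finite_range (fun i => sNorm (P i))).bddAbove
  have hK0 : 0 ≤ K := (sNorm_nonneg (P 0)).trans (hK ⟨0, rfl⟩)
  intro x0
  rw [Metric.tendsto_atTop]
  intro ε hε
  have hgt2 : Tendsto (fun m => K * Real.exp (mumax * η₁) * g m * ‖x0‖) atTop (𝓝 0) := by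
    simpa using (hgt.const_mul (K * Real.exp (mumax * η₁))).mul_const ‖x0‖
  obtain ⟨m0, hm0⟩ := eventually_atTop.mp (hgt2.eventually (gt_mem_nhds hε))
  refine ⟨t m0, fun s hs => ?_⟩
  rw [Real.dist_eq, sub_zero, abs_norm]
  unfold sol pc
  split_ifs with hex
  · obtain ⟨h1, h2⟩ := hex.choose_spec
    generalize hex.choose = m at h1 h2 ⊢
    have hmm : m0 ≤ m := by
      have : t m0 < t (m + 1) := lt_of_le_of_lt hs h2
      have := htm.lt_iff_lt.mp this
      omega
    refine lt_of_le_of_lt ?_ (hm0 m hmm)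
    refine (aux_norm n _ _).trans (mul_le_mul_of_nonneg_right ?_ (norm_nonneg _))
    rw [aux_map_mul, aux_exp n _ _ _ (hdiag (v m)), Matrix.mul_assoc]
    refine (sNorm_mul _ _).trans (mul_le_mul_of_nonneg_right ?_ (sNorm_nonneg _))
    refine (sNorm_mul _ _).trans ?_
    exact mul_le_mul (hK ⟨_, rfl⟩) ((hdg _ _ (by linarith)).trans
      (hexpb m _ (by linarith) (by linarith))) (sNorm_nonneg _) hK0
  · simpa using hε
end
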